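/- f has a physical measure μ whose basin of attraction B(μ) has full m-measure if and only if the set 𝒪 of observable measures of f consists of a single measure; in that case 𝒪 = {μ}. -/

import Mathlib

open MeasureTheory Filter Set Topology
open scoped ENNReal NNReal

/-- A metric on a topological space `P` (here: the space `𝒫` of Borel probability
measures with the weak* topology) inducing its topology; `d` plays the role of `dist*`. -/
structure CompatibleMetric (P : Type*) [TopologicalSpace P] where
  d : P → P → ℝ
  symm : ∀ x y, d x y = d y x
  triangle : ∀ x y z, d x z ≤ d x y + d y z
  eq_iff_dist_eq_zero : ∀ x y, d x y = 0 ↔ x = y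
  nhds_iff : ∀ (x : P) (s : Set P), s ∈ nhds x ↔ ∃ ε > 0, {y | d x y < ε} ⊆ s

/-- The diameter of a set of measures w.r.t. the metric `D.d`. -/
noncomputable def diamD {P : Type*} [TopologicalSpace P] (D : CompatibleMetric P)
    (A : Set P) : ℝ :=
  sSup (Set.image2 D.d A A)

variable {M : Type*} [MeasurableSpace M] [TopologicalSpace M] [OpensMeasurableSpace M]

/-- The empirical measure `σ_{n+1,x} = (1/(n+1)) ∑_{j=0}^{n} δ_{f^j(x)}`
(index shifted so that it is defined for every `n : ℕ`). -/
noncomputable def empiric (f : M → M) (x : M) (n : ℕ) : ProbabilityMeasure M :=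
  ⟨((n : ℝ≥0∞) + 1)⁻¹ • ∑ j ∈ Finset.range (n + 1), Measure.dirac (f^[j] x), by
    constructor
    rw [Measure.smul_apply, Measure.finset_sum_apply]
    simp only [measure_univ, Finset.sum_const, Finset.card_range, nsmul_eq_mul, mul_one,
      smul_eq_mul]
    rw [Nat.cast_add, Nat.cast_one]
    exact ENNReal.inv_mul_cancel (by simp)
      (ENNReal.add_ne_top.2 ⟨ENNReal.natCast_ne_top n, ENNReal.one_ne_top⟩)⟩

/-- `pω(x)`: the set of weak* limit points of the sequence of empirical measures
of the orbit of `x`. -/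
def pomega (f : M → M) (x : M) : Set (ProbabilityMeasure M) :=
  {μ | MapClusterPt μ atTop (empiric f x)}

/-- The basin of attraction `B(K) = {x : pω(x) ⊆ K}` of a set of probability measures. -/
def basin (f : M → M) (K : Set (ProbabilityMeasure M)) : Set M :=
  {x | pomega f x ⊆ K}

/-- `μ` is observable: for all `ε > 0` the `ε`-basin of partial attraction
`A_ε(μ) = {x : dist*(pω(x), μ) < ε}` has positive `m`-measure. -/
def Observable (D : CompatibleMetric (ProbabilityMeasure M)) (m : Measure M)
    (f : M → M) (μ : ProbabilityMeasure M) : Prop :=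
  ∀ ε > 0, 0 < m {x | ∃ ν ∈ pomega f x, D.d ν μ < ε}

/-- `μ` is a physical measure: its basin `{x : pω(x) = {μ}}` has positive `m`-measure. -/
def PhysicalMeasure (m : Measure M) (f : M → M) (μ : ProbabilityMeasure M) : Prop :=
  0 < m {x | pomega f x = {μ}}

/-- A generalized attractor (reduction of the set `𝒪` of observable measures): a nonempty
weak*-compact set of observable measures whose basin has positive `m`-measure. -/
def GenAttractor (D : CompatibleMetric (ProbabilityMeasure M)) (m : Measure M)
    (f : M → M) (A : Set (ProbabilityMeasure M)) : Prop :=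
  A.Nonempty ∧ IsCompact A ∧ (∀ μ ∈ A, Observable D m f μ) ∧ 0 < m (basin f A)

/-- Two generalized attractors are independent if the basin of their intersection is null. -/
def IndepGA (m : Measure M) (f : M → M) (A B : Set (ProbabilityMeasure M)) : Prop :=
  m (basin f (A ∩ B)) = 0

/-- A co-chain: an (at most countable) family of pairwise independent generalized attractors. -/
def IsCochain (D : CompatibleMetric (ProbabilityMeasure M)) (m : Measure M) (f : M → M)
    (S : Set (Set (ProbabilityMeasure M))) : Prop :=
  S.Countable ∧ (∀ A ∈ S, GenAttractor D m f A) ∧ S.Pairwise (IndepGA m f)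

/-- A chain: a (finite or countably infinite) sequence, indexed by `I ⊆ ℕ`, of generalized
attractors that is strictly decreasing under inclusion. -/
def IsChainGA (D : CompatibleMetric (ProbabilityMeasure M)) (m : Measure M) (f : M → M)
    (I : Set ℕ) (c : ℕ → Set (ProbabilityMeasure M)) : Prop :=
  I.Nonempty ∧ (∀ i ∈ I, GenAttractor D m f (c i)) ∧
    ∀ i ∈ I, ∀ j ∈ I, j < i → c i ⊂ c j

/-- Two chains are independent if each contains a member independent of some member
of the other. -/
def IndepChainPair (m : Measure M) (f : M → M)
    (p q : Set ℕ × (ℕ → Set (ProbabilityMeasure M))) : Prop :=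
  (∃ i ∈ p.1, ∃ j ∈ q.1, IndepGA m f (p.2 i) (q.2 j)) ∧
    (∃ j ∈ q.1, ∃ i ∈ p.1, IndepGA m f (q.2 j) (p.2 i))

/-- `k`: the supremum of the lengths (cardinalities) of co-chains of generalized attractors. -/
noncomputable def cochainSup (D : CompatibleMetric (ProbabilityMeasure M)) (m : Measure M)
    (f : M → M) : Cardinal :=
  sSup {c : Cardinal | ∃ S, IsCochain D m f S ∧ c = Cardinal.mk S}

/-- `h`: the supremum of the cardinalities of (at most countable) families of pairwise
independent chains of generalized attractors. -/
noncomputable def indepChainFamilySup (D : CompatibleMetric (ProbabilityMeasure M))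
    (m : Measure M) (f : M → M) : Cardinal :=
  sSup {c : Cardinal | ∃ F : Set (Set ℕ × (ℕ → Set (ProbabilityMeasure M))),
    F.Countable ∧ (∀ p ∈ F, IsChainGA D m f p.1 p.2) ∧ F.Pairwise (IndepChainPair m f) ∧
    c = Cardinal.mk F}

/-- An irreducible generalized attractor: one containing no proper compact subset that is
itself a generalized attractor. -/
def IrreducibleGA (D : CompatibleMetric (ProbabilityMeasure M)) (m : Measure M) (f : M → M)
    (A : Set (ProbabilityMeasure M)) : Prop :=
  GenAttractor D m f A ∧ ∀ K, IsCompact K → K ⊂ A → ¬ GenAttractor D m f K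

/-- The integral of a bounded continuous function against an empirical measure is its Birkhoff
average. -/
lemma integral_empiric (f : M → M) (x : M) (n : ℕ) (g : BoundedContinuousFunction M ℝ) :
    ∫ y, g y ∂(empiric f x n : Measure M) =
      ((n : ℝ≥0∞) + 1)⁻¹.toReal * ∑ j ∈ Finset.range (n + 1), g (f^[j] x) := by
  change ∫ y, g y ∂(((n : ℝ≥0∞) + 1)⁻¹ •
    ∑ j ∈ Finset.range (n + 1), Measure.dirac (f^[j] x)) = _
  rw [integral_smul_measure, integral_finsetSum_measure fun j _ => g.integrable _]
  simp only [integral_dirac' _ _ g.continuous.stronglyMeasurable, smul_eq_mul]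

lemma continuous_empiric {f : M → M} (hf : Continuous f) (n : ℕ) :
    Continuous fun x => empiric f x n := by
  rw [ProbabilityMeasure.continuous_iff_forall_continuous_integral]
  intro g
  simp only [integral_empiric]
  exact continuous_const.mul
    (continuous_finsetSum _ fun j _ => g.continuous.comp (hf.iterate j))

lemma CompatibleMetric.nonneg {P : Type*} [TopologicalSpace P] (D : CompatibleMetric P)
    (x y : P) : 0 ≤ D.d x y := by
  have h := D.triangle x y x
  rw [(D.eq_iff_dist_eq_zero x x).2 rfl, D.symm y x] at h
  linarith

lemma CompatibleMetric.pos_of_ne {P : Type*} [TopologicalSpace P] (D : CompatibleMetric P)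
    {x y : P} (h : x ≠ y) : 0 < D.d x y :=
  (D.nonneg x y).lt_of_ne fun h0 => h ((D.eq_iff_dist_eq_zero x y).1 h0.symm)

lemma pomega_nonempty [CompactSpace (ProbabilityMeasure M)] (f : M → M) (x : M) :
    (pomega f x).Nonempty :=
  exists_clusterPt_of_compactSpace _

lemma pomega_eq_singleton_iff_tendsto [CompactSpace (ProbabilityMeasure M)]
    [T2Space (ProbabilityMeasure M)] {f : M → M} {x : M} {μ : ProbabilityMeasure M} :
    pomega f x = {μ} ↔ Tendsto (empiric f x) atTop (𝓝 μ) := by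
  refine ⟨fun h => le_nhds_of_unique_clusterPt fun ν hν => ?_, fun h => ?_⟩
  · have : ν ∈ pomega f x := hν
    rwa [h] at this
  · refine (pomega_nonempty f x).subset_singleton_iff.1 fun ν hν => ?_
    have hν' : ClusterPt ν (map (empiric f x) atTop) := hν
    exact eq_of_nhds_neBot (hν'.mono h)

lemma measurableSet_pomega_eq_singleton [CompactSpace (ProbabilityMeasure M)]
    [TopologicalSpace.MetrizableSpace (ProbabilityMeasure M)] {f : M → M} (hf : Continuous f)
    (μ : ProbabilityMeasure M) : MeasurableSet {x | pomega f x = {μ}} := by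
  let _ := TopologicalSpace.metrizableSpaceMetric (ProbabilityMeasure M)
  simp only [pomega_eq_singleton_iff_tendsto]
  simp_rw [tendsto_iff_dist_tendsto_zero (f := empiric f _)]
  exact measurableSet_tendsto _ fun n =>
    ((continuous_empiric hf n).dist continuous_const).measurable

/-- If the basin `{x | pω(x) = {μ}}` has full measure, then `μ` is the only observable measure. -/
lemma setOf_observable_eq_singleton (D : CompatibleMetric (ProbabilityMeasure M))
    {m : Measure M} [NeZero m] {f : M → M} {μ : ProbabilityMeasure M}
    (h : ∀ᵐ x ∂m, pomega f x = {μ}) :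
    {ν : ProbabilityMeasure M | Observable D m f ν} = {μ} := by
  ext ν
  simp only [mem_ofPred_eq, mem_singleton_iff]
  constructor
  · intro hν
    by_contra hne
    refine (hν _ (D.pos_of_ne (Ne.symm hne))).ne' (measure_mono_null ?_ h)
    rintro x ⟨ν', hν', hlt⟩ (hx : pomega f x = {μ})
    rw [hx, mem_singleton_iff] at hν'
    exact lt_irrefl _ (hν' ▸ hlt)
  · rintro rfl ε hε
    refine pos_iff_ne_zero.2 fun h0 => ?_
    have hnot : ∀ᵐ x ∂m, ¬ ∃ ν' ∈ pomega f x, D.d ν' ν < ε :=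
      measure_eq_zero_iff_ae_notMem.1 h0
    obtain ⟨x, hx, hx'⟩ := (h.and hnot).exists
    exact hx' ⟨ν, by simp [hx], by rwa [(D.eq_iff_dist_eq_zero ν ν).2 rfl]⟩

/-- Almost every point has all its limit measures in the set of observable measures. -/
lemma ae_pomega_subset_observable [SecondCountableTopology (ProbabilityMeasure M)]
    (D : CompatibleMetric (ProbabilityMeasure M)) (m : Measure M) (f : M → M) :
    ∀ᵐ x ∂m, pomega f x ⊆ {ν | Observable D m f ν} := by
  have key : ∀ ν : ProbabilityMeasure M, ∃ ε > 0, ¬ Observable D m f ν →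
      m {x | ∃ ν' ∈ pomega f x, D.d ν' ν < ε} = 0 := by
    intro ν
    by_cases hν : Observable D m f ν
    · exact ⟨1, one_pos, fun h => absurd hν h⟩
    · have hν' := hν
      simp only [Observable, not_forall, not_lt, nonpos_iff_eq_zero] at hν'
      obtain ⟨ε, hε, h0⟩ := hν'
      exact ⟨ε, hε, fun _ => h0⟩
  choose ε hε h0 using key
  obtain ⟨t, hts, htc, hcov⟩ := TopologicalSpace.countable_cover_nhdsWithin
    (s := {ν | ¬ Observable D m f ν}) (f := fun ν => {y | D.d ν y < ε ν})
    fun ν _ => mem_nhdsWithin_of_mem_nhds ((D.nhds_iff ν _).2 ⟨ε ν, hε ν, Subset.rfl⟩)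
  have hae : ∀ᵐ x ∂m, ∀ ν ∈ t, ¬ ∃ ν' ∈ pomega f x, D.d ν' ν < ε ν :=
    (ae_ball_iff htc).2 fun ν hν => measure_eq_zero_iff_ae_notMem.1 (h0 ν (hts hν))
  filter_upwards [hae] with x hx ν' hν'
  by_contra hobs
  obtain ⟨ν, hνt, hlt⟩ := mem_iUnion₂.1 (hcov hobs)
  exact hx ν hνt ⟨ν', hν', by rw [D.symm]; exact hlt⟩

/-- `f` has a physical measure whose basin has full `m`-measure iff the set of
observable measures is a single measure; in that case they coincide. -/
theorem physical_full_basin_iff_unique_observable {M : Type*} [MetricSpace M] [CompactSpace M] [MeasurableSpace M] [BorelSpace M]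
    (D : CompatibleMetric (ProbabilityMeasure M))
    (m : Measure M) [IsProbabilityMeasure m]
    (f : M → M) (hf : Continuous f) :
    ((∃ μ : ProbabilityMeasure M, m {x | pomega f x = {μ}} = 1) ↔
      (∃ μ : ProbabilityMeasure M,
        {ν : ProbabilityMeasure M | Observable D m f ν} = {μ})) ∧
    ∀ μ : ProbabilityMeasure M, m {x | pomega f x = {μ}} = 1 →
      {ν : ProbabilityMeasure M | Observable D m f ν} = {μ} := by
  have full : ∀ μ : ProbabilityMeasure M, m {x | pomega f x = {μ}} = 1 →
      {ν : ProbabilityMeasure M | Observable D m f ν} = {μ} := fun μ hμ =>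
    setOf_observable_eq_singleton D
      ((prob_compl_eq_zero_iff (measurableSet_pomega_eq_singleton hf μ)).2 hμ)
  refine ⟨⟨fun ⟨μ, hμ⟩ => ⟨μ, full μ hμ⟩, fun ⟨μ, hμ⟩ => ⟨μ, ?_⟩⟩, full⟩
  have : SecondCountableTopology (ProbabilityMeasure M) := by
    let _ := TopologicalSpace.metrizableSpaceMetric (ProbabilityMeasure M)
    infer_instance
  have hae : ∀ᵐ x ∂m, pomega f x = {μ} := by
    filter_upwards [ae_pomega_subset_observable D m f] with x hx
    rw [hμ] at hx
    exact (pomega_nonempty f x).subset_singleton_iff.1 hx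
  exact (prob_compl_eq_zero_iff (measurableSet_pomega_eq_singleton hf μ)).1 hae
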